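/- arXiv:1507.04851 — 2 statements merged into one kernel-verified Lean document; each statement's English description precedes it below -/
import Mathlib

section
/- Let f₁, f₂, g₁, g₂ : ℝ → ℝ be smooth functions with compact support and let a ≤ b be real numbers. For ε₁, ε₂ ∈ ℝ define H(ε₁, ε₂) := ∫_a^{b+ε₁+ε₂} (g₁*g₂)(x) dx − ∫_{a−ε₂}^{b+ε₁} (g₁*f₂)(x) dx − ∫_{a−ε₁}^{b+ε₂} (f₁*g₂)(x) dx + ∫_{a−ε₁−ε₂}^{b} (f₁*f₂)(x) dx. Then for every ε₁ the function ε₂ ↦ H(ε₁, ε₂) is differentiable at ε₂ = 0, and the function ε₁ ↦ (d/dε₂)|_{ε₂=0} H(ε₁, ε₂) is differentiable at ε₁ = 0 with derivative equal to (g₁*g₂)′(b) − (f₁*f₂)′(a). -/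
open MeasureTheory intervalIntegral

/-- Convolution of two real functions with respect to Lebesgue measure. -/
noncomputable def conv (u v : ℝ → ℝ) (x : ℝ) : ℝ := ∫ y, u y * v (x - y)

theorem conv_eq_convolution (u v : ℝ → ℝ) :
    conv u v = MeasureTheory.convolution u v (ContinuousLinearMap.mul ℝ ℝ) volume :=
  rfl

theorem differentiable_conv {u v : ℝ → ℝ} (hu : Continuous u) (hv : ContDiff ℝ 1 v)
    (hvc : HasCompactSupport v) : Differentiable ℝ (conv u v) := fun x =>
  conv_eq_convolution u v ▸ (hvc.hasDerivAt_convolution_right (ContinuousLinearMap.mul ℝ ℝ)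
    hu.locallyIntegrable hv x).differentiableAt

theorem Continuous.hasDerivAt_integral_comp_upper {h : ℝ → ℝ} (hh : Continuous h) (c : ℝ)
    {u : ℝ → ℝ} {u' t : ℝ} (hu : HasDerivAt u u' t) :
    HasDerivAt (fun s => ∫ x in c..u s, h x) (h (u t) * u') t :=
  (integral_hasDerivAt_right (hh.intervalIntegrable c (u t))
    (hh.stronglyMeasurableAtFilter volume _) hh.continuousAt).comp t hu

theorem Continuous.hasDerivAt_integral_comp_lower {h : ℝ → ℝ} (hh : Continuous h) (c : ℝ)
    {u : ℝ → ℝ} {u' t : ℝ} (hu : HasDerivAt u u' t) :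
    HasDerivAt (fun s => ∫ x in u s..c, h x) (-h (u t) * u') t :=
  (integral_hasDerivAt_left (hh.intervalIntegrable (u t) c)
    (hh.stronglyMeasurableAtFilter volume _) hh.continuousAt).comp t hu

/-- The iterated derivative computation at the core of the formula
`φ₁*φ₂([a,b]) = (g₁*g₂)′(b) − (f₁*f₂)′(a)` for convolution of compactly supported
smooth valuations on `ℝ`. -/
theorem stmt5 (f₁ f₂ g₁ g₂ : ℝ → ℝ)
    (hf₁ : ContDiff ℝ (⊤ : ℕ∞) f₁) (hf₂ : ContDiff ℝ (⊤ : ℕ∞) f₂)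
    (hg₁ : ContDiff ℝ (⊤ : ℕ∞) g₁) (hg₂ : ContDiff ℝ (⊤ : ℕ∞) g₂)
    (hf₁c : HasCompactSupport f₁) (hf₂c : HasCompactSupport f₂)
    (hg₁c : HasCompactSupport g₁) (hg₂c : HasCompactSupport g₂)
    (a b : ℝ) (hab : a ≤ b)
    (H : ℝ → ℝ → ℝ)
    (hH : ∀ ε₁ ε₂ : ℝ, H ε₁ ε₂ =
      (∫ x in a..(b + ε₁ + ε₂), conv g₁ g₂ x)
      - (∫ x in (a - ε₂)..(b + ε₁), conv g₁ f₂ x)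
      - (∫ x in (a - ε₁)..(b + ε₂), conv f₁ g₂ x)
      + (∫ x in (a - ε₁ - ε₂)..b, conv f₁ f₂ x)) :
    (∀ ε₁ : ℝ, DifferentiableAt ℝ (fun ε₂ => H ε₁ ε₂) 0) ∧
    HasDerivAt (fun ε₁ => deriv (fun ε₂ => H ε₁ ε₂) 0)
      (deriv (conv g₁ g₂) b - deriv (conv f₁ f₂) a) 0 := by
  have hle : (1 : WithTop ℕ∞) ≤ ((⊤ : ℕ∞) : WithTop ℕ∞) := by exact_mod_cast le_top
  have hgg := differentiable_conv hg₁.continuous (hg₂.of_le hle) hg₂c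
  have hgf := differentiable_conv hg₁.continuous (hf₂.of_le hle) hf₂c
  have hfg := differentiable_conv hf₁.continuous (hg₂.of_le hle) hg₂c
  have hff := differentiable_conv hf₁.continuous (hf₂.of_le hle) hf₂c
  have inner_deriv : ∀ ε₁ : ℝ, HasDerivAt (fun ε₂ => H ε₁ ε₂)
      (conv g₁ g₂ (b + ε₁) - conv g₁ f₂ a - conv f₁ g₂ b + conv f₁ f₂ (a - ε₁)) 0 := by
    intro ε₁
    simp only [hH]
    have add_id (c : ℝ) : HasDerivAt (fun s : ℝ => c + s) 1 0 := (hasDerivAt_id _).const_add c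
    have sub_id (c : ℝ) : HasDerivAt (fun s : ℝ => c - s) (-1) 0 := (hasDerivAt_id _).const_sub c
    refine ((((hgg.continuous.hasDerivAt_integral_comp_upper a (add_id (b + ε₁))).sub
      (hgf.continuous.hasDerivAt_integral_comp_lower (b + ε₁) (sub_id a))).sub
      (hfg.continuous.hasDerivAt_integral_comp_upper (a - ε₁) (add_id b))).add
      (hff.continuous.hasDerivAt_integral_comp_lower b (sub_id (a - ε₁)))).congr_deriv ?_
    simp
  refine ⟨fun ε₁ => (inner_deriv ε₁).differentiableAt, ?_⟩
  simp only [fun ε₁ => (inner_deriv ε₁).deriv]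
  have hb : HasDerivAt (fun ε => conv g₁ g₂ (b + ε)) (deriv (conv g₁ g₂) b) 0 :=
    HasDerivAt.comp_const_add b 0 (by simpa using (hgg b).hasDerivAt)
  have ha : HasDerivAt (fun ε => conv f₁ f₂ (a - ε)) (-deriv (conv f₁ f₂) a) 0 :=
    HasDerivAt.comp_const_sub a 0 (by simpa using (hff a).hasDerivAt)
  exact (((hb.sub_const _).sub_const _).add ha).congr_deriv (sub_eq_add_neg _ _).symm
end

section
/- Let u : ℝ^m → ℝ be a continuous function with compact support, and let B and B_i (i ∈ ℕ) be nonempty compact convex subsets of ℝ^m such that the Hausdorff distance between B_i and B tends to 0 as i → ∞. Then the functions x ↦ ∫_{B_i} u(x − y) dy converge uniformly on ℝ^m to the function x ↦ ∫_{B} u(x − y) dy. -/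
open MeasureTheory Filter

open Metric in
/-- A complete convex set whose `r`-thickening contains a closed ball of radius `r` contains the
centre of that ball. -/
theorem Convex.mem_of_closedBall_subset_thickening {E : Type*} [NormedAddCommGroup E]
    [InnerProductSpace ℝ E] {K : Set E} (hK : Convex ℝ K) (hKc : IsComplete K)
    (hKne : K.Nonempty) {x : E} {r : ℝ} (hr : 0 ≤ r) (h : closedBall x r ⊆ Metric.thickening r K) :
    x ∈ K := by
  obtain ⟨p, hpK, hp⟩ := exists_norm_eq_iInf_of_complete_convex hKne hKc hK x
  rw [norm_eq_iInf_iff_real_inner_le_zero hK hpK] at hp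
  by_contra hx
  have hd : 0 < ‖x - p‖ := norm_sub_pos_iff.2 fun hxp => hx (hxp ▸ hpK)
  have hz : x + (r / ‖x - p‖) • (x - p) ∈ closedBall x r := by
    rw [mem_closedBall, dist_eq_norm, add_sub_cancel_left, norm_smul, Real.norm_of_nonneg
      (by positivity), div_mul_cancel₀ _ hd.ne']
  obtain ⟨b, hb, hzb⟩ := mem_thickening_iff.1 (h hz)
  rw [dist_eq_norm] at hzb
  have hcs := real_inner_le_norm (x - p) (x + (r / ‖x - p‖) • (x - p) - b)
  have hsplit : x + (r / ‖x - p‖) • (x - p) - b =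
      (x - p) + (r / ‖x - p‖) • (x - p) - (b - p) := by abel
  have hexp : inner ℝ (x - p) (x + (r / ‖x - p‖) • (x - p) - b) =
      ‖x - p‖ ^ 2 + r * ‖x - p‖ - inner ℝ (x - p) (b - p) := by
    rw [hsplit, inner_sub_right, inner_add_right, real_inner_smul_right,
      real_inner_self_eq_norm_sq]
    field_simp
  nlinarith [hp b hb, mul_lt_mul_of_pos_left hzb hd, sq_nonneg ‖x - p‖]

open Metric Topology in
/-- The volume of the symmetric difference tends to zero along a Hausdorff-convergent sequence of
nonempty compact convex sets. -/
theorem tendsto_measure_symmDiff_of_tendsto_hausdorffDist {E ι : Type*} [NormedAddCommGroup E]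
    [InnerProductSpace ℝ E] [FiniteDimensional ℝ E] [MeasurableSpace E] [BorelSpace E]
    (μ : Measure E) [μ.IsAddHaarMeasure] {l : Filter ι} [l.IsCountablyGenerated]
    {A : ι → Set E} {B : Set E} (hBc : IsCompact B) (hBne : B.Nonempty) (hB : Convex ℝ B)
    (hAc : ∀ i, IsCompact (A i)) (hAne : ∀ i, (A i).Nonempty) (hA : ∀ i, Convex ℝ (A i))
    (h : Tendsto (fun i => hausdorffDist (A i) B) l (𝓝 0)) :
    Tendsto (fun i => μ (symmDiff (A i) B)) l (𝓝 0) := by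
  have hfin i : hausdorffEDist (A i) B ≠ ⊤ :=
    hausdorffEDist_ne_top_of_nonempty_of_bounded (hAne i) hBne (hAc i).isBounded hBc.isBounded
  have hsub {r : ℝ} (hr : 0 < r) : ∀ᶠ i in l, A i ⊆ thickening r B := by
    filter_upwards [h.eventually_lt_const hr] with i hi y hy
    exact mem_thickening_iff.2 (exists_dist_lt_of_hausdorffDist_lt hy hi (hfin i))
  have hsup {r : ℝ} (hr : 0 < r) : ∀ᶠ i in l, B ⊆ thickening r (A i) := by
    filter_upwards [h.eventually_lt_const hr] with i hi y hy
    obtain ⟨z, hz, hzy⟩ := exists_dist_lt_of_hausdorffDist_lt' hy hi (hfin i)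
    exact mem_thickening_iff.2 ⟨z, hz, by rwa [dist_comm]⟩
  rw [← measure_empty (μ := μ)]
  refine tendsto_measure_of_ae_tendsto_indicator l MeasurableSet.empty
    (fun i => (hAc i).measurableSet.symmDiff hBc.measurableSet)
    (isOpen_thickening (δ := 1) (E := B)).measurableSet
    hBc.isBounded.thickening.measure_lt_top.ne ?_ ?_
  · filter_upwards [hsub one_pos] with i hi
    exact Set.union_subset (Set.sdiff_subset.trans hi)
      (Set.sdiff_subset.trans (self_subset_thickening one_pos B))
  · filter_upwards [measure_eq_zero_iff_ae_notMem.1 (hB.addHaar_frontier μ)] with x hx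
    by_cases hxB : x ∈ B
    · have hxi : x ∈ interior B := by
        by_contra hxi
        exact hx ⟨subset_closure hxB, hxi⟩
      obtain ⟨r, hr, hball⟩ := nhds_basis_closedBall.mem_iff.1 (mem_interior_iff_mem_nhds.1 hxi)
      filter_upwards [hsup hr] with i hi
      have hxA : x ∈ A i := (hA i).mem_of_closedBall_subset_thickening (hAc i).isComplete
        (hAne i) hr.le (hball.trans hi)
      simp [Set.mem_symmDiff, hxA, hxB]
    · have hpos := (hBc.isClosed.notMem_iff_infDist_pos hBne).1 hxB
      filter_upwards [hsub hpos] with i hi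
      have hxA : x ∉ A i := fun hxA => by
        obtain ⟨z, hz, hxz⟩ := mem_thickening_iff.1 (hi hxA)
        exact (infDist_le_dist_of_mem hz).not_gt hxz
      simp [Set.mem_symmDiff, hxA, hxB]

/-- Integrals of a bounded function over two sets differ by at most a constant multiple of the
measure of the symmetric difference. -/
theorem norm_setIntegral_sub_setIntegral_le_symmDiff {X F : Type*} [MeasurableSpace X]
    [NormedAddCommGroup F] [NormedSpace ℝ F] {μ : Measure X} {f : X → F} {s t : Set X} {C : ℝ}
    (hs : MeasurableSet s) (ht : MeasurableSet t) (hfs : IntegrableOn f s μ)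
    (hft : IntegrableOn f t μ) (hst : μ (symmDiff s t) ≠ ⊤) (hC : ∀ x, ‖f x‖ ≤ C) :
    ‖∫ x in s, f x ∂μ - ∫ x in t, f x ∂μ‖ ≤ C * μ.real (symmDiff s t) := by
  have h₁ : μ (s \ t) ≠ ⊤ := measure_ne_top_of_subset Set.subset_union_left hst
  have h₂ : μ (t \ s) ≠ ⊤ := measure_ne_top_of_subset Set.subset_union_right hst
  have hdisj : Disjoint (s \ t) (t \ s) := disjoint_sdiff_sdiff
  have hunion : μ.real (symmDiff s t) = μ.real (s \ t) + μ.real (t \ s) :=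
    measureReal_union hdisj (ht.diff hs) h₁ h₂
  rw [← integral_inter_add_sdiff ht hfs, ← integral_inter_add_sdiff hs hft, Set.inter_comm t s,
    add_sub_add_left_eq_sub, hunion, mul_add]
  exact (norm_sub_le _ _).trans (add_le_add
    (norm_setIntegral_le_of_norm_le_const h₁.lt_top fun x _ => hC x)
    (norm_setIntegral_le_of_norm_le_const h₂.lt_top fun x _ => hC x))

/-- If `u : ℝ^m → ℝ` is continuous with compact support, and `B_i` are nonempty compact
convex sets converging in Hausdorff distance to the nonempty compact convex set `B`,
then `x ↦ ∫_{B_i} u(x - y) dy` converges uniformly to `x ↦ ∫_B u(x - y) dy`. -/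
theorem stmt8 (m : ℕ) (u : EuclideanSpace ℝ (Fin m) → ℝ)
    (hu : Continuous u) (husupp : HasCompactSupport u)
    (B : Set (EuclideanSpace ℝ (Fin m))) (Bi : ℕ → Set (EuclideanSpace ℝ (Fin m)))
    (hBc : IsCompact B) (hBne : B.Nonempty) (hBconv : Convex ℝ B)
    (hBic : ∀ i, IsCompact (Bi i)) (hBine : ∀ i, (Bi i).Nonempty)
    (hBiconv : ∀ i, Convex ℝ (Bi i))
    (hdist : Tendsto (fun i => Metric.hausdorffDist (Bi i) B) atTop (nhds 0)) :
    TendstoUniformly (fun i x => ∫ y in Bi i, u (x - y)) (fun x => ∫ y in B, u (x - y))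
      atTop := by
  obtain ⟨C, hC⟩ := husupp.exists_bound_of_continuous hu
  have hvol := tendsto_measure_symmDiff_of_tendsto_hausdorffDist volume hBc hBne hBconv hBic hBine
    hBiconv hdist
  have hlim : Tendsto (fun i => C * volume.real (symmDiff (Bi i) B)) atTop (nhds 0) := by
    simpa [Measure.real] using
      ((ENNReal.tendsto_toReal ENNReal.zero_ne_top).comp hvol).const_mul C
  rw [Metric.tendstoUniformly_iff]
  intro ε hε
  filter_upwards [hlim.eventually_lt_const hε] with i hi x
  have hcont : Continuous fun y => u (x - y) := by fun_prop
  rw [dist_comm, dist_eq_norm]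
  refine (norm_setIntegral_sub_setIntegral_le_symmDiff (hBic i).measurableSet hBc.measurableSet
    (hcont.continuousOn.integrableOn_compact (hBic i))
    (hcont.continuousOn.integrableOn_compact hBc) ?_ fun y => hC (x - y)).trans_lt hi
  exact measure_ne_top_of_subset (Set.union_subset_union Set.sdiff_subset Set.sdiff_subset)
    ((hBic i).union hBc).measure_lt_top.ne
end
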